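/- arXiv:2311.00459 — 2 statements merged into one kernel-verified Lean document; each statement's English description precedes it below -/
import Mathlib

section
/- For β₁, β₂ ∈ ℂ, the transposed Poisson algebras T₀₃^{β₁} and T₀₃^{β₂} are isomorphic if and only if β₁ = β₂ or β₁ = −β₂. -/
noncomputable section

abbrev V3 : Type := Fin 3 → ℂ

def e (i : Fin 3) : V3 := Pi.single i 1

def IsoPair {L M : Type*} [AddCommGroup L] [Module ℂ L] [AddCommGroup M] [Module ℂ M]
    (m₁ b₁ : L → L → L) (m₂ b₂ : M → M → M) : Prop :=
  ∃ φ : L ≃ₗ[ℂ] M, (∀ x y, φ (m₁ x y) = m₂ (φ x) (φ y)) ∧ (∀ x y, φ (b₁ x y) = b₂ (φ x) (φ y))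

def bh : V3 → V3 → V3 := fun x y => ![(0 : ℂ), (0 : ℂ), (x 0 * y 1 - x 1 * y 0)]

def mT03 (β : ℂ) : V3 → V3 → V3 := fun x y => ![(0 : ℂ), (0 : ℂ), (β * (x 0 * y 1 + x 1 * y 0))]

lemma sq_eq_sq_of_isoPair {β₁ β₂ : ℂ} (h : IsoPair (mT03 β₁) bh (mT03 β₂) bh) :
    β₁ ^ 2 = β₂ ^ 2 := by
  obtain ⟨φ, hm, hb⟩ := h
  have hbr : bh (e 0) (e 1) = e 2 := by
    ext i; fin_cases i <;> simp [bh, e]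
  have hmul : mT03 β₁ (e 0) (e 1) = β₁ • e 2 := by
    ext i; fin_cases i <;> simp [mT03, e]
  have hsq₀ : mT03 β₁ (e 0) (e 0) = 0 := by
    ext i; fin_cases i <;> simp [mT03, e]
  have h3 := hb (e 0) (e 1)
  have h12 := congrFun (hm (e 0) (e 1)) 2
  have h11 := congrFun (hm (e 0) (e 0)) 2
  rw [hbr] at h3
  rw [hmul, map_smul, h3] at h12
  rw [hsq₀, map_zero] at h11
  simp only [mT03, bh, Pi.smul_apply, Pi.zero_apply, smul_eq_mul, Matrix.cons_val] at h12 h11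
  have hD : φ (e 0) 0 * φ (e 1) 1 - φ (e 0) 1 * φ (e 1) 0 ≠ 0 := by
    intro h0
    have hzero : φ (e 2) = 0 := by
      rw [h3]
      ext i; fin_cases i <;> simp [bh, h0]
    have h2 := congrFun (φ.map_eq_zero_iff.mp hzero) 2
    simp [e] at h2
  generalize φ (e 0) 0 = a at *
  generalize φ (e 0) 1 = b at *
  generalize φ (e 1) 0 = c at *
  generalize φ (e 1) 1 = d at *
  apply mul_right_cancel₀ (pow_ne_zero 2 hD)
  linear_combination
    (β₁ * (a * d - b * c) + β₂ * (a * d + b * c)) * h12 - 2 * β₂ * c * d * h11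

/-- Exchange the first two basis vectors and negate the third. -/
def swapNeg : V3 ≃ₗ[ℂ] V3 where
  toFun x := ![x 1, x 0, -x 2]
  invFun x := ![x 1, x 0, -x 2]
  map_add' x y := by
    ext i; fin_cases i <;> simp [add_comm]
  map_smul' r x := by
    ext i; fin_cases i <;> simp
  left_inv x := by
    ext i; fin_cases i <;> simp
  right_inv x := by
    ext i; fin_cases i <;> simp

lemma isoPair_neg (β : ℂ) : IsoPair (mT03 (-β)) bh (mT03 β) bh := by
  refine ⟨swapNeg, fun x y => ?_, fun x y => ?_⟩
  · ext i; fin_cases i <;> simp [swapNeg, mT03, add_comm]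
  · ext i; fin_cases i <;> simp [swapNeg, bh]

theorem statement15 (β₁ β₂ : ℂ) :
    IsoPair (mT03 β₁) bh (mT03 β₂) bh ↔ (β₁ = β₂ ∨ β₁ = -β₂) := by
  constructor
  · exact fun h => sq_eq_sq_iff_eq_or_eq_neg.mp (sq_eq_sq_of_isoPair h)
  · rintro (rfl | rfl)
    · exact ⟨LinearEquiv.refl ℂ V3, fun _ _ => rfl, fun _ _ => rfl⟩
    · exact isoPair_neg β₂
end
end

section
/- Let (A, ·) be one of the following 2-dimensional commutative associative ℂ-algebras with basis e₁, e₂ (only nonzero products listed): A₀₁: e₁·e₁ = e₁, e₂·e₂ = e₂; A₀₃: e₁·e₁ = e₁; A₀₄: e₁·e₁ = e₂. Then for every derivation D of (A, ·), one has D(x)·y − x·D(y) = 0 for all x, y ∈ A. -/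
noncomputable section

abbrev V2 : Type := Fin 2 → ℂ

def mA01 : V2 → V2 → V2 := fun x y => ![(x 0 * y 0), (x 1 * y 1)]

def mA03 : V2 → V2 → V2 := fun x y => ![(x 0 * y 0), (0 : ℂ)]

def mA04 : V2 → V2 → V2 := fun x y => ![(0 : ℂ), (x 0 * y 0)]

theorem V2.linearMap_apply (D : V2 →ₗ[ℂ] V2) (x : V2) (i : Fin 2) :
    D x i = x 0 * D ![1, 0] i + x 1 * D ![0, 1] i := by
  have hx : x = x 0 • ![1, 0] + x 1 • ![0, 1] := by
    ext j
    fin_cases j <;> simp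
  conv_lhs => rw [hx]
  simp only [map_add, map_smul, Pi.add_apply, Pi.smul_apply, smul_eq_mul]

theorem statement16 (m : V2 → V2 → V2)
    (hmem : m = mA01 ∨ m = mA03 ∨ m = mA04)
    (D : V2 →ₗ[ℂ] V2)
    (hD : ∀ x y, D (m x y) = m (D x) y + m x (D y)) :
    ∀ x y, m (D x) y - m x (D y) = 0 := by
  intro x y
  have hDi (x y : V2) (i : Fin 2) : D (m x y) i = m (D x) y i + m x (D y) i :=
    congrFun (hD x y) i
  have h₁₁ := hDi ![1, 0] ![1, 0]
  have h₁₂ := hDi ![1, 0] ![0, 1]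
  have h₂₂ := hDi ![0, 1] ![0, 1]
  rw [Fin.forall_fin_two] at h₁₁ h₁₂ h₂₂
  ext i
  rcases hmem with rfl | rfl | rfl
  · simp only [mA01, V2.linearMap_apply D ![_ * _, _]] at h₁₁ h₁₂ h₂₂
    fin_cases i <;>
      simp [mA01, V2.linearMap_apply D x, V2.linearMap_apply D y] at h₁₁ h₁₂ h₂₂ ⊢ <;> grind
  · simp only [mA03, V2.linearMap_apply D ![_ * _, _]] at h₁₁ h₁₂ h₂₂
    fin_cases i <;>
      simp [mA03, V2.linearMap_apply D x, V2.linearMap_apply D y] at h₁₁ h₁₂ h₂₂ ⊢ <;> grind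
  · simp only [mA04, V2.linearMap_apply D ![0, _ * _]] at h₁₁ h₁₂ h₂₂
    fin_cases i <;>
      simp [mA04, V2.linearMap_apply D x, V2.linearMap_apply D y] at h₁₁ h₁₂ h₂₂ ⊢ <;> grind
end
end
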